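/- (Lemma 1: finite-time convergence of the control target system.) Let L > 0, 0 < ε₁ ≤ ε₂, μ₁, μ₂ > 0, k_s, k_f ∈ ℝ; let a_{ij}, g_{ij} : [0,L] → ℝ (i,j ∈ {1,2}) and θ : [0,L] → ℝ and b_{ij}, c_{ij} : [0,L]² → ℝ be continuous. Suppose α_s, α_f, β_s, β_f are C¹ on [0,L] × [0,∞) and satisfy, for all x ∈ [0,L], t ≥ 0: ∂_t α_s + ε₁ ∂_x α_s = a₁₁(x)α_s + a₁₂(x)α_f + g₁₁(x)β_s + g₁₂(x)β_f + ∫₀ˣ (b₁₁(x,ξ)α_s(ξ,t) + b₁₂(x,ξ)α_f(ξ,t) + c₁₁(x,ξ)β_s(ξ,t) + c₁₂(x,ξ)β_f(ξ,t)) dξ; ∂_t α_f + ε₂ ∂_x α_f = a₂₁(x)α_s + a₂₂(x)α_f + g₂₁(x)β_s + g₂₂(x)β_f + ∫₀ˣ (b₂₁(x,ξ)α_s(ξ,t) + b₂₂(x,ξ)α_f(ξ,t) + c₂₁(x,ξ)β_s(ξ,t) + c₂₂(x,ξ)β_f(ξ,t)) dξ; ∂_t β_s − μ₁ ∂_x β_s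 = 0; ∂_t β_f − μ₂ ∂_x β_f = θ(x)·β_s(0,t); with boundary conditions α_s(0,t) = k_s β_s(0,t), α_f(0,t) = k_f β_f(0,t), β_s(L,t) = 0, β_f(L,t) = 0 for all t ≥ 0. Then α_s(x,t) = α_f(x,t) = β_s(x,t) = β_f(x,t) = 0 for all x ∈ [0,L] and all t ≥ t_f, where t_f := L/ε₁ + L/μ₁ + L/μ₂. -/

import Mathlib

theorem abs_sub_le_sub_of_abs_hasDerivAt_le {f B f' B' : ℝ → ℝ} {a b : ℝ} (hab : a ≤ b)
    (hf : ContinuousOn f (Set.Icc a b)) (hB : ContinuousOn B (Set.Icc a b))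
    (hf' : ∀ s ∈ Set.Ioo a b, HasDerivAt f (f' s) s)
    (hB' : ∀ s ∈ Set.Ioo a b, HasDerivAt B (B' s) s)
    (hle : ∀ s ∈ Set.Ioo a b, |f' s| ≤ B' s) : |f b - f a| ≤ B b - B a := by
  have hsub : MonotoneOn (fun s => B s - f s) (Set.Icc a b) := by
    refine monotoneOn_of_hasDerivWithinAt_nonneg (f' := fun s => B' s - f' s) (convex_Icc a b)
      (hB.sub hf) ?_ ?_ <;> rw [interior_Icc] <;> intro s hs
    · exact ((hB' s hs).sub (hf' s hs)).hasDerivWithinAt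
    · have := (abs_le.1 (hle s hs)).2
      linarith
  have hadd : MonotoneOn (fun s => B s + f s) (Set.Icc a b) := by
    refine monotoneOn_of_hasDerivWithinAt_nonneg (f' := fun s => B' s + f' s) (convex_Icc a b)
      (hB.add hf) ?_ ?_ <;> rw [interior_Icc] <;> intro s hs
    · exact ((hB' s hs).add (hf' s hs)).hasDerivWithinAt
    · have := (abs_le.1 (hle s hs)).1
      linarith
  have h₁ := hsub (Set.left_mem_Icc.2 hab) (Set.right_mem_Icc.2 hab) hab
  have h₂ := hadd (Set.left_mem_Icc.2 hab) (Set.right_mem_Icc.2 hab) hab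
  simp only at h₁ h₂
  rw [abs_le]
  constructor <;> linarith

theorem hasDerivAt_along_line {u : ℝ → ℝ → ℝ} {x₀ t₀ c s : ℝ}
    (hu : DifferentiableAt ℝ (Function.uncurry u) (x₀ + c * s, t₀ + s)) :
    HasDerivAt (fun r => u (x₀ + c * r) (t₀ + r))
      (deriv (fun r => u (x₀ + c * s) r) (t₀ + s)
        + c * deriv (fun y => u y (t₀ + s)) (x₀ + c * s)) s := by
  have hF := hu.hasFDerivAt
  set F := fderiv ℝ (Function.uncurry u) (x₀ + c * s, t₀ + s)
  have ht : HasDerivAt (fun r => u (x₀ + c * s) r) (F (0, 1)) (t₀ + s) :=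
    HasFDerivAt.comp_hasDerivAt (l := Function.uncurry u) (t₀ + s) hF
      ((hasDerivAt_const (t₀ + s) (x₀ + c * s)).prodMk (hasDerivAt_id (t₀ + s)))
  have hx : HasDerivAt (fun y => u y (t₀ + s)) (F (1, 0)) (x₀ + c * s) :=
    HasFDerivAt.comp_hasDerivAt (l := Function.uncurry u) (x₀ + c * s) hF
      ((hasDerivAt_id (x₀ + c * s)).prodMk (hasDerivAt_const (x₀ + c * s) (t₀ + s)))
  have hl : HasDerivAt (fun r => u (x₀ + c * r) (t₀ + r)) (F (c * 1, 1)) s :=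
    HasFDerivAt.comp_hasDerivAt (l := Function.uncurry u) s hF
      ((((hasDerivAt_id s).const_mul c).const_add x₀).prodMk ((hasDerivAt_id s).const_add t₀))
  have hsplit : ((c * 1, 1) : ℝ × ℝ) = (0, 1) + c • (1, 0) := by simp
  rw [hsplit, map_add, map_smul, smul_eq_mul] at hl
  rwa [ht.deriv, hx.deriv]

theorem abs_sub_le_along_characteristic {u : ℝ → ℝ → ℝ} {L x₀ t₀ c S : ℝ} {B B' : ℝ → ℝ}
    (hu : ContDiffOn ℝ 1 (Function.uncurry u) (Set.Icc 0 L ×ˢ Set.Ici 0))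
    (hS : 0 ≤ S) (ht₀ : 0 ≤ t₀)
    (hcl : ∀ s ∈ Set.Icc 0 S, x₀ + c * s ∈ Set.Icc 0 L)
    (hop : ∀ s ∈ Set.Ioo 0 S, x₀ + c * s ∈ Set.Ioo 0 L)
    (hB : ∀ s, HasDerivAt B (B' s) s)
    (hle : ∀ s ∈ Set.Ioo 0 S, |deriv (fun r => u (x₀ + c * s) r) (t₀ + s)
        + c * deriv (fun y => u y (t₀ + s)) (x₀ + c * s)| ≤ B' s) :
    |u (x₀ + c * S) (t₀ + S) - u x₀ t₀| ≤ B S - B 0 := by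
  have hmain := abs_sub_le_sub_of_abs_hasDerivAt_le (f := fun r => u (x₀ + c * r) (t₀ + r)) hS
    (hu.continuousOn.comp (f := fun r => (x₀ + c * r, t₀ + r)) (by fun_prop) fun s hs =>
      ⟨hcl s hs, add_nonneg ht₀ hs.1⟩)
    (fun s _ => (hB s).continuousAt.continuousWithinAt)
    (fun s hs => hasDerivAt_along_line <| (hu.differentiableOn one_ne_zero).differentiableAt <|
      prod_mem_nhds (Icc_mem_nhds (hop s hs).1 (hop s hs).2)
        (Ici_mem_nhds (add_pos_of_nonneg_of_pos ht₀ hs.1)))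
    (fun s _ => hB s) hle
  simpa using hmain

theorem upstream_eq_zero {u : ℝ → ℝ → ℝ} {L μ T : ℝ} (hμ : 0 < μ) (hT : 0 ≤ T)
    (hu : ContDiffOn ℝ 1 (Function.uncurry u) (Set.Icc 0 L ×ˢ Set.Ici 0))
    (hpde : ∀ x ∈ Set.Icc 0 L, ∀ t, T ≤ t →
      deriv (fun s => u x s) t - μ * deriv (fun y => u y t) x = 0)
    (hbc : ∀ t, T ≤ t → u L t = 0) {x t : ℝ} (hx : x ∈ Set.Icc 0 L) (ht : T + L / μ ≤ t) :
    u x t = 0 := by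
  have hS : 0 ≤ (L - x) / μ := div_nonneg (sub_nonneg.2 hx.2) hμ.le
  have hSL : (L - x) / μ ≤ L / μ := by gcongr; linarith [hx.1]
  have hmul : μ * ((L - x) / μ) = L - x := by field_simp
  have hop : ∀ s ∈ Set.Ioo 0 ((L - x) / μ), L + -μ * s ∈ Set.Ioo 0 L := fun s hs => by
    have h₁ := mul_pos hμ hs.1
    have h₂ := mul_lt_mul_of_pos_left hs.2 hμ
    constructor <;> linarith [hx.1]
  have h := abs_sub_le_along_characteristic (t₀ := t - (L - x) / μ) (B := fun _ => 0)
    (B' := fun _ => 0) hu hS (by linarith) (fun s hs => ?_) hop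
    (fun s => hasDerivAt_const s 0) (fun s hs => ?_)
  · have hx' : L + -μ * ((L - x) / μ) = x := by linarith
    rw [hbc _ (by linarith), hx', sub_add_cancel] at h
    simpa using h
  · have h₁ := mul_nonneg hμ.le hs.1
    have h₂ := mul_le_mul_of_nonneg_left hs.2 hμ.le
    constructor <;> linarith [hx.1]
  · have := hpde _ (Set.Ioo_subset_Icc_self (hop s hs)) (t - (L - x) / μ + s) (by linarith [hs.1])
    rw [neg_mul μ (deriv _ _), ← sub_eq_add_neg, this, abs_zero]

theorem abs_downstream_le {u : ℝ → ℝ → ℝ} {L ε x t k D : ℝ} (hε : 0 < ε) (hk : 0 < k)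
    (hD : 0 ≤ D) (hu : ContDiffOn ℝ 1 (Function.uncurry u) (Set.Icc 0 L ×ˢ Set.Ici 0))
    (hx : x ∈ Set.Icc 0 L) (ht : x / ε ≤ t) (hbc : u 0 (t - x / ε) = 0)
    (hle : ∀ y ∈ Set.Icc 0 x, |deriv (fun r => u y r) (t - (x - y) / ε)
        + ε * deriv (fun z => u z (t - (x - y) / ε)) y| ≤ D * Real.exp (k * y)) :
    |u x t| ≤ D / (k * ε) * Real.exp (k * x) := by
  have hS : 0 ≤ x / ε := div_nonneg hx.1 hε.le
  have hmul : ε * (x / ε) = x := by field_simp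
  have hpath : ∀ s ∈ Set.Icc 0 (x / ε), ε * s ∈ Set.Icc 0 x := fun s hs =>
    ⟨mul_nonneg hε.le hs.1, by linarith [mul_le_mul_of_nonneg_left hs.2 hε.le]⟩
  have h := abs_sub_le_along_characteristic (x₀ := 0) (c := ε) (t₀ := t - x / ε)
    (B := fun s => D / (k * ε) * Real.exp (k * (ε * s)))
    (B' := fun s => D * Real.exp (k * (ε * s))) hu hS (by linarith) (fun s hs => ?_)
    (fun s hs => ?_) (fun s => ?_) (fun s hs => ?_)
  · rw [hbc, zero_add, hmul, sub_add_cancel, sub_zero] at h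
    have : 0 ≤ D / (k * ε) * Real.exp (k * (ε * 0)) := by positivity
    linarith
  · rw [zero_add]
    exact ⟨(hpath s hs).1, (hpath s hs).2.trans hx.2⟩
  · rw [zero_add]
    exact ⟨mul_pos hε hs.1, by linarith [mul_lt_mul_of_pos_left hs.2 hε, hx.2]⟩
  · have := ((((hasDerivAt_id s).const_mul ε).const_mul k).exp).const_mul (D / (k * ε))
    refine this.congr_deriv ?_
    simp only [id_eq]
    field_simp
  · have htime : t - (x - ε * s) / ε = t - x / ε + s := by field_simp; ring
    have := hle (ε * s) (hpath s (Set.Ioo_subset_Icc_self hs))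
    simpa only [zero_add, htime] using this

theorem exists_abs_source_le {L : ℝ} (hL : 0 < L) {a₁ a₂ : ℝ → ℝ} (g₁ g₂ : ℝ → ℝ)
    {b₁ b₂ : ℝ → ℝ → ℝ} (c₁ c₂ : ℝ → ℝ → ℝ)
    (ha₁ : ContinuousOn a₁ (Set.Icc 0 L)) (ha₂ : ContinuousOn a₂ (Set.Icc 0 L))
    (hb₁ : ContinuousOn (Function.uncurry b₁) (Set.Icc 0 L ×ˢ Set.Icc 0 L))
    (hb₂ : ContinuousOn (Function.uncurry b₂) (Set.Icc 0 L ×ˢ Set.Icc 0 L)) :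
    ∃ C, ∀ x ∈ Set.Icc 0 L, ∀ (p q r w : ℝ → ℝ) (E : ℝ),
      (∀ ξ ∈ Set.Icc 0 x, |p ξ| ≤ E ∧ |q ξ| ≤ E ∧ r ξ = 0 ∧ w ξ = 0) →
      |a₁ x * p x + a₂ x * q x + g₁ x * r x + g₂ x * w x
        + ∫ ξ in (0:ℝ)..x, (b₁ x ξ * p ξ + b₂ x ξ * q ξ + c₁ x ξ * r ξ + c₂ x ξ * w ξ)|
        ≤ C * E := by
  obtain ⟨A₁, hA₁⟩ := isCompact_Icc.exists_bound_of_continuousOn ha₁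
  obtain ⟨A₂, hA₂⟩ := isCompact_Icc.exists_bound_of_continuousOn ha₂
  obtain ⟨B₁, hB₁⟩ := (isCompact_Icc.prod isCompact_Icc).exists_bound_of_continuousOn hb₁
  obtain ⟨B₂, hB₂⟩ := (isCompact_Icc.prod isCompact_Icc).exists_bound_of_continuousOn hb₂
  have h0 : (0 : ℝ) ∈ Set.Icc 0 L := ⟨le_rfl, hL.le⟩
  have hpair : ∀ {α β p q A B E : ℝ}, |α| ≤ A → |β| ≤ B → |p| ≤ E → |q| ≤ E →
      |α * p + β * q| ≤ (A + B) * E := fun {α β p q A B E} hα hβ hp hq => by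
    have h₁ : |α * p| ≤ A * E := by
      rw [abs_mul]; exact mul_le_mul hα hp (abs_nonneg _) ((abs_nonneg _).trans hα)
    have h₂ : |β * q| ≤ B * E := by
      rw [abs_mul]; exact mul_le_mul hβ hq (abs_nonneg _) ((abs_nonneg _).trans hβ)
    linarith [abs_add_le (α * p) (β * q)]
  refine ⟨A₁ + A₂ + (B₁ + B₂) * L, fun x hx p q r w E h => ?_⟩
  obtain ⟨hp, hq, hr, hw⟩ := h x ⟨hx.1, le_rfl⟩
  have hlocal := hpair (hA₁ x hx) (hA₂ x hx) hp hq
  have hint : ‖∫ ξ in (0:ℝ)..x, (b₁ x ξ * p ξ + b₂ x ξ * q ξ + c₁ x ξ * r ξ + c₂ x ξ * w ξ)‖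
      ≤ (B₁ + B₂) * E * |x - 0| := by
    refine intervalIntegral.norm_integral_le_of_norm_le_const fun ξ hξ => ?_
    rw [Set.uIoc_of_le hx.1] at hξ
    obtain ⟨hp, hq, hr, hw⟩ := h ξ ⟨hξ.1.le, hξ.2⟩
    have hmem : (x, ξ) ∈ Set.Icc 0 L ×ˢ Set.Icc 0 L := ⟨hx, hξ.1.le, hξ.2.trans hx.2⟩
    rw [hr, hw, mul_zero, mul_zero, add_zero, add_zero]
    exact hpair (hB₁ _ hmem) (hB₂ _ hmem) hp hq
  have hBE : 0 ≤ (B₁ + B₂) * E :=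
    mul_nonneg (add_nonneg ((norm_nonneg _).trans (hB₁ (0, 0) ⟨h0, h0⟩))
      ((norm_nonneg _).trans (hB₂ (0, 0) ⟨h0, h0⟩))) ((abs_nonneg _).trans hp)
  rw [sub_zero, abs_of_nonneg hx.1, Real.norm_eq_abs] at hint
  have hxL := mul_le_mul_of_nonneg_left hx.2 hBE
  rw [hr, hw, mul_zero, mul_zero, add_zero, add_zero]
  refine (abs_add_le _ _).trans ?_
  linarith


/-- Lemma 1: finite-time convergence of the control target system. All four
states of the backstepping target system vanish for t ≥ t_f, where
t_f = L/ε₁ + L/μ₁ + L/μ₂. -/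
theorem stmt_12
    (L ε₁ ε₂ μ₁ μ₂ ks kf : ℝ)
    (hL : 0 < L) (hε₁ : 0 < ε₁) (hε : ε₁ ≤ ε₂) (hμ₁ : 0 < μ₁) (hμ₂ : 0 < μ₂)
    (a₁₁ a₁₂ a₂₁ a₂₂ g₁₁ g₁₂ g₂₁ g₂₂ θ : ℝ → ℝ)
    (b₁₁ b₁₂ b₂₁ b₂₂ c₁₁ c₁₂ c₂₁ c₂₂ : ℝ → ℝ → ℝ)
    (ha₁₁ : ContinuousOn a₁₁ (Set.Icc 0 L)) (ha₁₂ : ContinuousOn a₁₂ (Set.Icc 0 L))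
    (ha₂₁ : ContinuousOn a₂₁ (Set.Icc 0 L)) (ha₂₂ : ContinuousOn a₂₂ (Set.Icc 0 L))
    (hg₁₁ : ContinuousOn g₁₁ (Set.Icc 0 L)) (hg₁₂ : ContinuousOn g₁₂ (Set.Icc 0 L))
    (hg₂₁ : ContinuousOn g₂₁ (Set.Icc 0 L)) (hg₂₂ : ContinuousOn g₂₂ (Set.Icc 0 L))
    (hθ : ContinuousOn θ (Set.Icc 0 L))
    (hb₁₁ : ContinuousOn (Function.uncurry b₁₁) (Set.Icc 0 L ×ˢ Set.Icc 0 L))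
    (hb₁₂ : ContinuousOn (Function.uncurry b₁₂) (Set.Icc 0 L ×ˢ Set.Icc 0 L))
    (hb₂₁ : ContinuousOn (Function.uncurry b₂₁) (Set.Icc 0 L ×ˢ Set.Icc 0 L))
    (hb₂₂ : ContinuousOn (Function.uncurry b₂₂) (Set.Icc 0 L ×ˢ Set.Icc 0 L))
    (hc₁₁ : ContinuousOn (Function.uncurry c₁₁) (Set.Icc 0 L ×ˢ Set.Icc 0 L))
    (hc₁₂ : ContinuousOn (Function.uncurry c₁₂) (Set.Icc 0 L ×ˢ Set.Icc 0 L))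
    (hc₂₁ : ContinuousOn (Function.uncurry c₂₁) (Set.Icc 0 L ×ˢ Set.Icc 0 L))
    (hc₂₂ : ContinuousOn (Function.uncurry c₂₂) (Set.Icc 0 L ×ˢ Set.Icc 0 L))
    (αs αf βs βf : ℝ → ℝ → ℝ)
    (hαs : ContDiffOn ℝ 1 (Function.uncurry αs) (Set.Icc 0 L ×ˢ Set.Ici 0))
    (hαf : ContDiffOn ℝ 1 (Function.uncurry αf) (Set.Icc 0 L ×ˢ Set.Ici 0))
    (hβs : ContDiffOn ℝ 1 (Function.uncurry βs) (Set.Icc 0 L ×ˢ Set.Ici 0))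
    (hβf : ContDiffOn ℝ 1 (Function.uncurry βf) (Set.Icc 0 L ×ˢ Set.Ici 0))
    (hpde_αs : ∀ x ∈ Set.Icc (0:ℝ) L, ∀ t ∈ Set.Ici (0:ℝ),
      deriv (fun s => αs x s) t + ε₁ * deriv (fun y => αs y t) x
        = a₁₁ x * αs x t + a₁₂ x * αf x t + g₁₁ x * βs x t + g₁₂ x * βf x t
          + ∫ ξ in (0:ℝ)..x, (b₁₁ x ξ * αs ξ t + b₁₂ x ξ * αf ξ t
              + c₁₁ x ξ * βs ξ t + c₁₂ x ξ * βf ξ t))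
    (hpde_αf : ∀ x ∈ Set.Icc (0:ℝ) L, ∀ t ∈ Set.Ici (0:ℝ),
      deriv (fun s => αf x s) t + ε₂ * deriv (fun y => αf y t) x
        = a₂₁ x * αs x t + a₂₂ x * αf x t + g₂₁ x * βs x t + g₂₂ x * βf x t
          + ∫ ξ in (0:ℝ)..x, (b₂₁ x ξ * αs ξ t + b₂₂ x ξ * αf ξ t
              + c₂₁ x ξ * βs ξ t + c₂₂ x ξ * βf ξ t))
    (hpde_βs : ∀ x ∈ Set.Icc (0:ℝ) L, ∀ t ∈ Set.Ici (0:ℝ),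
      deriv (fun s => βs x s) t - μ₁ * deriv (fun y => βs y t) x = 0)
    (hpde_βf : ∀ x ∈ Set.Icc (0:ℝ) L, ∀ t ∈ Set.Ici (0:ℝ),
      deriv (fun s => βf x s) t - μ₂ * deriv (fun y => βf y t) x
        = θ x * βs 0 t)
    (hbc_αs : ∀ t ∈ Set.Ici (0:ℝ), αs 0 t = ks * βs 0 t)
    (hbc_αf : ∀ t ∈ Set.Ici (0:ℝ), αf 0 t = kf * βf 0 t)
    (hbc_βs : ∀ t ∈ Set.Ici (0:ℝ), βs L t = 0)
    (hbc_βf : ∀ t ∈ Set.Ici (0:ℝ), βf L t = 0) :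
    ∀ x ∈ Set.Icc (0:ℝ) L, ∀ t : ℝ, L / ε₁ + L / μ₁ + L / μ₂ ≤ t →
      αs x t = 0 ∧ αf x t = 0 ∧ βs x t = 0 ∧ βf x t = 0 := by
  have hLμ₁ : 0 < L / μ₁ := div_pos hL hμ₁
  have hLμ₂ : 0 < L / μ₂ := div_pos hL hμ₂
  have hε₂ : 0 < ε₂ := hε₁.trans_le hε
  have h0 : (0 : ℝ) ∈ Set.Icc 0 L := ⟨le_rfl, hL.le⟩
  have hβs0 : ∀ x ∈ Set.Icc 0 L, ∀ t, L / μ₁ ≤ t → βs x t = 0 := fun x hx t ht =>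
    upstream_eq_zero hμ₁ le_rfl hβs hpde_βs hbc_βs hx (by linarith)
  have hβf0 : ∀ x ∈ Set.Icc 0 L, ∀ t, L / μ₁ + L / μ₂ ≤ t → βf x t = 0 := fun x hx t ht =>
    upstream_eq_zero hμ₂ hLμ₁.le hβf
      (fun x hx t ht => by
        rw [hpde_βf x hx t (hLμ₁.le.trans ht), hβs0 0 h0 t ht, mul_zero])
      (fun t ht => hbc_βf t (hLμ₁.le.trans ht)) hx ht
  obtain ⟨C₁, hC₁⟩ := exists_abs_source_le hL g₁₁ g₁₂ c₁₁ c₁₂ ha₁₁ ha₁₂ hb₁₁ hb₁₂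
  obtain ⟨C₂, hC₂⟩ := exists_abs_source_le hL g₂₁ g₂₂ c₂₁ c₂₂ ha₂₁ ha₂₂ hb₂₁ hb₂₂
  set C := max 1 (max C₁ C₂)
  have hC : 0 < C := zero_lt_one.trans_le (le_max_left _ _)
  have hCC₁ : C₁ ≤ C := (le_max_left _ _).trans (le_max_right _ _)
  have hCC₂ : C₂ ≤ C := (le_max_right _ _).trans (le_max_right _ _)
  set T₀ := L / μ₁ + L / μ₂
  have hT₀ : 0 ≤ T₀ := by positivity
  set k := 2 * C / ε₁
  have hk : 0 < k := by positivity
  intro x hx t ht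
  have hxε : x / ε₁ ≤ L / ε₁ := by gcongr; exact hx.2
  have htx : T₀ + x / ε₁ ≤ t := by linarith
  have hcompact : IsCompact (Set.Icc 0 L ×ˢ Set.Icc 0 t) := isCompact_Icc.prod isCompact_Icc
  have hsub : Set.Icc 0 L ×ˢ Set.Icc 0 t ⊆ Set.Icc 0 L ×ˢ Set.Ici 0 :=
    Set.prod_mono_right fun _ h => h.1
  obtain ⟨Ms, hMs⟩ := hcompact.exists_bound_of_continuousOn (hαs.continuousOn.mono hsub)
  obtain ⟨Mf, hMf⟩ := hcompact.exists_bound_of_continuousOn (hαf.continuousOn.mono hsub)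
  have hM : 0 ≤ max Ms Mf :=
    (norm_nonneg _).trans ((hMs (0, 0) ⟨h0, le_rfl, by
      linarith [div_nonneg hx.1 hε₁.le]⟩).trans (le_max_left _ _))
  have hstep : ∀ n : ℕ, ∀ y ∈ Set.Icc 0 L, ∀ τ, T₀ + y / ε₁ ≤ τ → τ ≤ t →
      |αs y τ| ≤ max Ms Mf / 2 ^ n * Real.exp (k * y) ∧
        |αf y τ| ≤ max Ms Mf / 2 ^ n * Real.exp (k * y) := by
    intro n
    induction n with
    | zero =>
      intro y hy τ hτ hτt
      have hmem : (y, τ) ∈ Set.Icc 0 L ×ˢ Set.Icc 0 t :=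
        ⟨hy, by linarith [div_nonneg hy.1 hε₁.le], hτt⟩
      have hexp : max Ms Mf ≤ max Ms Mf / 2 ^ 0 * Real.exp (k * y) := by
        rw [pow_zero, div_one]
        exact le_mul_of_one_le_right hM (Real.one_le_exp (mul_nonneg hk.le hy.1))
      exact ⟨((hMs _ hmem).trans (le_max_left _ _)).trans hexp,
        ((hMf _ hmem).trans (le_max_right _ _)).trans hexp⟩
    | succ n ih =>
      intro y hy τ hτ hτt
      set N := max Ms Mf / 2 ^ n with hN
      have hN0 : 0 ≤ N := by positivity
      have hhalf : ∀ ε, ε₁ ≤ ε →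
          C * N / (k * ε) * Real.exp (k * y)
            ≤ max Ms Mf / 2 ^ (n + 1) * Real.exp (k * y) := fun ε hle => by
        have hε0 : 0 < ε := hε₁.trans_le hle
        refine mul_le_mul_of_nonneg_right ?_ (Real.exp_pos _).le
        have : C * N / (k * ε) = ε₁ / ε * (N / 2) := by
          simp only [k]; field_simp
        rw [this, pow_succ, ← div_div, ← hN]
        exact mul_le_of_le_one_left (by positivity) ((div_le_one hε0).2 hle)
      have hregion : ∀ ε, ε₁ ≤ ε → ∀ z ∈ Set.Icc 0 y,
          T₀ + z / ε₁ ≤ τ - (y - z) / ε ∧ τ - (y - z) / ε ≤ t := fun ε hle z hz => by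
        have hyz : 0 ≤ y - z := sub_nonneg.2 hz.2
        have h₁ : (y - z) / ε ≤ (y - z) / ε₁ := div_le_div_of_nonneg_left hyz hε₁ hle
        have h₂ : 0 ≤ (y - z) / ε := div_nonneg hyz (hε₁.le.trans hle)
        rw [sub_div y z ε₁] at h₁
        constructor <;> linarith
      have hvals : ∀ z ∈ Set.Icc 0 y, ∀ σ, T₀ + z / ε₁ ≤ σ → σ ≤ t → ∀ ξ ∈ Set.Icc 0 z,
          |αs ξ σ| ≤ N * Real.exp (k * z) ∧ |αf ξ σ| ≤ N * Real.exp (k * z) ∧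
            βs ξ σ = 0 ∧ βf ξ σ = 0 := fun z hz σ hσ hσt ξ hξ => by
        have hξL : ξ ∈ Set.Icc 0 L := ⟨hξ.1, hξ.2.trans (hz.2.trans hy.2)⟩
        have hξz : ξ / ε₁ ≤ z / ε₁ := by gcongr; exact hξ.2
        have hξ0 : 0 ≤ ξ / ε₁ := div_nonneg hξ.1 hε₁.le
        have hmono : N * Real.exp (k * ξ) ≤ N * Real.exp (k * z) := by gcongr; exact hξ.2
        obtain ⟨hs, hf⟩ := ih ξ hξL σ (by linarith) hσt
        exact ⟨hs.trans hmono, hf.trans hmono,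
          hβs0 ξ hξL σ (by simp only [T₀] at hσ; linarith), hβf0 ξ hξL σ (by linarith)⟩
      have hstart : ∀ ε, ε₁ ≤ ε → T₀ ≤ τ - y / ε := fun ε hle => by
        have := (hregion ε hle 0 ⟨le_rfl, hy.1⟩).1
        simpa using this
      constructor
      · refine (abs_downstream_le hε₁ hk (mul_nonneg hC.le hN0) hαs hy
          (by linarith [hstart ε₁ le_rfl]) ?_ fun z hz => ?_).trans (hhalf ε₁ le_rfl)
        · have := hstart ε₁ le_rfl
          rw [hbc_αs _ (hT₀.trans this), hβs0 0 h0 _ (by simp only [T₀] at this; linarith),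
            mul_zero]
        · obtain ⟨hσ, hσt⟩ := hregion ε₁ le_rfl z hz
          have hzL : z ∈ Set.Icc 0 L := ⟨hz.1, hz.2.trans hy.2⟩
          have hz0 : 0 ≤ z / ε₁ := div_nonneg hz.1 hε₁.le
          rw [hpde_αs z hzL _ (by simp only [Set.mem_Ici]; linarith)]
          refine (hC₁ z hzL (fun ξ => αs ξ _) (fun ξ => αf ξ _) (fun ξ => βs ξ _)
            (fun ξ => βf ξ _) _ (hvals z hz _ hσ hσt)).trans ?_
          rw [mul_assoc]
          gcongr
      · refine (abs_downstream_le hε₂ hk (mul_nonneg hC.le hN0) hαf hy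
          (by linarith [hstart ε₂ hε]) ?_ fun z hz => ?_).trans (hhalf ε₂ hε)
        · have := hstart ε₂ hε
          rw [hbc_αf _ (hT₀.trans this), hβf0 0 h0 _ this, mul_zero]
        · obtain ⟨hσ, hσt⟩ := hregion ε₂ hε z hz
          have hzL : z ∈ Set.Icc 0 L := ⟨hz.1, hz.2.trans hy.2⟩
          have hz0 : 0 ≤ z / ε₁ := div_nonneg hz.1 hε₁.le
          rw [hpde_αf z hzL _ (by simp only [Set.mem_Ici]; linarith)]
          refine (hC₂ z hzL (fun ξ => αs ξ _) (fun ξ => αf ξ _) (fun ξ => βs ξ _)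
            (fun ξ => βf ξ _) _ (hvals z hz _ hσ hσt)).trans ?_
          rw [mul_assoc]
          gcongr
  have hlim : Filter.Tendsto (fun n : ℕ => max Ms Mf / 2 ^ n * Real.exp (k * x))
      Filter.atTop (nhds 0) := by
    have := ((tendsto_const_nhds (x := max Ms Mf)).div_atTop
      (tendsto_pow_atTop_atTop_of_one_lt (one_lt_two (α := ℝ)))).mul_const (Real.exp (k * x))
    rwa [zero_mul] at this
  have hx0 : 0 ≤ x / ε₁ := div_nonneg hx.1 hε₁.le
  exact ⟨abs_nonpos_iff.1 (ge_of_tendsto' hlim fun n => (hstep n x hx t htx le_rfl).1),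
    abs_nonpos_iff.1 (ge_of_tendsto' hlim fun n => (hstep n x hx t htx le_rfl).2),
    hβs0 x hx t (by simp only [T₀] at htx; linarith), hβf0 x hx t (by linarith)⟩
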